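/- Let G be a bipartite digraph with disjoint vertex classes {1, …, r} and {r+1, …, k} (every edge of G joins a vertex of one class to a vertex of the other class). Suppose A_1, …, A_r are stable and A_{r+1}, …, A_k are unstable. Let ρ_1 = max{‖P_j⁻¹P_i‖ : (i,j) ∈ E(G), i ∈ {1,…,r}}, ρ_2 = max{‖P_j⁻¹P_i‖ : (i,j) ∈ E(G), i ∈ {r+1,…,k}}, λ = min{λ_1, …, λ_r}, μ = max{μ_{r+1}, …, μ_k}, and β = −λτ + μη. If ln ρ_1 + ln ρ_2 + β < 0, then the switched system is asymptotically stable for every signal σ ∈ S_G(τ, η). -/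

import Mathlib

open Matrix Filter Topology Finset

attribute [local instance] Classical.propDecidable

noncomputable section

/-- The spectral (ℓ² operator) norm of a complex square matrix. -/
def sNorm {n : ℕ} (M : Matrix (Fin n) (Fin n) ℂ) : ℝ :=
  ‖Matrix.toEuclideanCLM (𝕜 := ℂ) M‖

/-- The spectral (ℓ² operator) norm of a real square matrix. -/
def sNormR {n : ℕ} (M : Matrix (Fin n) (Fin n) ℝ) : ℝ :=
  ‖Matrix.toEuclideanCLM (𝕜 := ℝ) M‖

/-- The ordered product `exp(A_{σ_m}(t_m - t_{m-1})) ⋯ exp(A_{σ_1} t_1)` of the switched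
system (0-based: `flow A t v m = exp((t m - t (m-1)) • A (v (m-1))) * ⋯ * exp((t 1 - t 0) • A (v 0))`). -/
def flow {n k : ℕ} (A : Fin k → Matrix (Fin n) (Fin n) ℝ)
    (t : ℕ → ℝ) (v : ℕ → Fin k) : ℕ → Matrix (Fin n) (Fin n) ℝ
  | 0 => 1
  | m + 1 => NormedSpace.exp ((t (m + 1) - t m) • A (v m)) * flow A t v m

/-- Piecewise evaluation: the value `f m` on the interval `[t m, t (m+1))`. -/
def pc {α : Type*} (t : ℕ → ℝ) (f : ℕ → α) (d : α) (s : ℝ) : α :=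
  if h : ∃ m, t m ≤ s ∧ s < t (m + 1) then f h.choose else d

/-- The solution of the switched system `x' = A_{σ(t)} x`, `x(0) = x0`:
for `s ∈ [t m, t (m+1))`, `x(s) = exp((s - t m) • A (v m)) * flow A t v m * x0`. -/
def sol {n k : ℕ} (A : Fin k → Matrix (Fin n) (Fin n) ℝ)
    (t : ℕ → ℝ) (v : ℕ → Fin k) (x0 : EuclideanSpace ℝ (Fin n)) (s : ℝ) :
    EuclideanSpace ℝ (Fin n) :=
  pc t (fun m => Matrix.toEuclideanCLM (𝕜 := ℝ)
    (NormedSpace.exp ((s - t m) • A (v m)) * flow A t v m) x0) 0 s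

/-- A `G`-admissible switching signal: `t 0 = 0`, strictly increasing switching times tending
to infinity, and consecutive vertices joined by edges of `G`.  Here `v m` is the vertex active
on `[t m, t (m+1))` (i.e. `v m = σ_{m+1}` in 1-based notation). -/
def Admissible {k : ℕ} (E : Set (Fin k × Fin k)) (t : ℕ → ℝ) (v : ℕ → Fin k) : Prop :=
  t 0 = 0 ∧ StrictMono t ∧ Tendsto t atTop atTop ∧ ∀ m, (v m, v (m + 1)) ∈ E

/-- A real matrix is stable if all its (complex) eigenvalues have negative real part. -/
def MStable {n : ℕ} (M : Matrix (Fin n) (Fin n) ℝ) : Prop :=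
  ∀ z ∈ spectrum ℂ (M.map (Complex.ofReal)), z.re < 0

/-- A real matrix is unstable if some eigenvalue has positive real part and no eigenvalue has
zero real part. -/
def MUnstable {n : ℕ} (M : Matrix (Fin n) (Fin n) ℝ) : Prop :=
  (∃ z ∈ spectrum ℂ (M.map (Complex.ofReal)), 0 < z.re) ∧
    ∀ z ∈ spectrum ℂ (M.map (Complex.ofReal)), z.re ≠ 0

/-- `a` is the maximum of the real parts of the eigenvalues of `M`. -/
def MaxRe {n : ℕ} (M : Matrix (Fin n) (Fin n) ℝ) (a : ℝ) : Prop :=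
  IsGreatest (Complex.re '' spectrum ℂ (M.map (Complex.ofReal))) a

/-- `M = P D P⁻¹` with `P` invertible and `D` diagonal (diagonalizability over `ℂ`). -/
def Diagonalized {n : ℕ} (M : Matrix (Fin n) (Fin n) ℝ)
    (P D : Matrix (Fin n) (Fin n) ℂ) : Prop :=
  IsUnit P ∧ D.IsDiag ∧ M.map (Complex.ofReal) = P * D * P⁻¹

/-- Asymptotic stability of the switched system for the given signal. -/
def AsympStable {n k : ℕ} (A : Fin k → Matrix (Fin n) (Fin n) ℝ)
    (t : ℕ → ℝ) (v : ℕ → Fin k) : Prop :=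
  ∀ x0 : EuclideanSpace ℝ (Fin n), Tendsto (fun s => ‖sol A t v x0 s‖) atTop (𝓝 0)

/-- Membership in the class `S_G(τ, η)`: dwell time at least `τ` in the stable subsystems
(indices `< r`), flee time at most `η` in the unstable subsystems (indices `≥ r`). -/
def InSG {k : ℕ} (r : ℕ) (τ η : ℝ) (t : ℕ → ℝ) (v : ℕ → Fin k) : Prop :=
  ∀ m, ((v m).1 < r → τ ≤ t (m + 1) - t m) ∧ (r ≤ (v m).1 → t (m + 1) - t m ≤ η)

end


section helpers

/-- Complexification of a real Euclidean vector. -/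
noncomputable def cvec {n : ℕ} (x : EuclideanSpace ℝ (Fin n)) : EuclideanSpace ℂ (Fin n) :=
  WithLp.toLp 2 (fun i => ((x i : ℝ) : ℂ))

lemma norm_cvec {n : ℕ} (x : EuclideanSpace ℝ (Fin n)) : ‖cvec x‖ = ‖x‖ := by
  simp [cvec, EuclideanSpace.norm_eq]

lemma cvec_apply {n : ℕ} (M : Matrix (Fin n) (Fin n) ℝ) (x : EuclideanSpace ℝ (Fin n)) :
    cvec (Matrix.toEuclideanCLM (𝕜 := ℝ) M x)
      = Matrix.toEuclideanCLM (𝕜 := ℂ) (M.map Complex.ofReal) (cvec x) := by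
  ext i
  simp [cvec, Matrix.mulVec, dotProduct]

lemma exp_map_ofReal {n : ℕ} (M : Matrix (Fin n) (Fin n) ℝ) :
    (NormedSpace.exp M).map Complex.ofReal = NormedSpace.exp (M.map Complex.ofReal) := by
  have hc : CompleteSpace (Matrix (Fin n) (Fin n) ℝ) := inferInstance
  let : NormedRing (Matrix (Fin n) (Fin n) ℝ) := Matrix.linftyOpNormedRing
  let : NormedAlgebra ℚ (Matrix (Fin n) (Fin n) ℝ) := Matrix.linftyOpNormedAlgebra
  let : NormedRing (Matrix (Fin n) (Fin n) ℂ) := Matrix.linftyOpNormedRing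

  have hc' : @CompleteSpace (Matrix (Fin n) (Fin n) ℝ) PseudoMetricSpace.toUniformSpace := hc
  have h := NormedSpace.map_exp (f := (Complex.ofRealHom.mapMatrix : Matrix (Fin n) (Fin n) ℝ →+* Matrix (Fin n) (Fin n) ℂ))
    (by
      show Continuous (fun M : Matrix (Fin n) (Fin n) ℝ => M.map Complex.ofReal)
      exact continuous_id.matrix_map Complex.continuous_ofReal) M
  exact h

lemma exp_smul_eq {n : ℕ} {M : Matrix (Fin n) (Fin n) ℝ} {P D : Matrix (Fin n) (Fin n) ℂ}
    (h : Diagonalized M P D) (u : ℝ) :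
    (NormedSpace.exp (u • M)).map Complex.ofReal
      = P * Matrix.diagonal (fun j => Complex.exp (u * D j j)) * P⁻¹ := by
  obtain ⟨hP, hD, hM⟩ := h
  rw [exp_map_ofReal]
  have h1 : (u • M).map Complex.ofReal = P * Matrix.diagonal (fun j => (u : ℂ) * D j j) * P⁻¹ := by
    have : (u • M).map Complex.ofReal = (u : ℂ) • M.map Complex.ofReal := by
      ext i j; simp
    rw [this, hM, ← Matrix.smul_mul, ← Matrix.mul_smul]
    congr 2
    conv_lhs => rw [← hD.diagonal_diag]
    ext i j
    by_cases hij : i = j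
    · subst hij; simp
    · simp [hij]
  rw [h1, Matrix.exp_conj _ _ hP, Matrix.exp_diagonal]
  congr 3
  funext j
  rw [Pi.coe_exp, Complex.exp_eq_exp_ℂ]

lemma diag_re_le {n : ℕ} {M : Matrix (Fin n) (Fin n) ℝ} {P D : Matrix (Fin n) (Fin n) ℂ}
    (h : Diagonalized M P D) {a : ℝ} (ha : MaxRe M a) (j : Fin n) : (D j j).re ≤ a := by
  obtain ⟨hP, hD, hM⟩ := h
  apply ha.2
  refine ⟨D j j, ?_, rfl⟩
  rw [hM]
  have h1 : spectrum ℂ (P * D * P⁻¹) = spectrum ℂ D := by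
    obtain ⟨U, rfl⟩ := hP
    rw [← Matrix.coe_units_inv]
    exact spectrum.units_conjugate
  rw [h1, ← hD.diagonal_diag, spectrum_diagonal]
  exact ⟨j, by simp⟩

open scoped Matrix.Norms.L2Operator in
lemma norm_diag_le {n : ℕ} {M : Matrix (Fin n) (Fin n) ℝ} {P D : Matrix (Fin n) (Fin n) ℂ}
    (h : Diagonalized M P D) {a : ℝ} (ha : MaxRe M a) {u : ℝ} (hu : 0 ≤ u) :
    sNorm (Matrix.diagonal (fun j => Complex.exp (u * D j j))) ≤ Real.exp (a * u) := by
  have h1 : sNorm (Matrix.diagonal (fun j => Complex.exp (u * D j j)))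
    = ‖(Matrix.diagonal (fun j => Complex.exp (u * D j j)))‖ := rfl
  rw [h1, Matrix.l2_opNorm_diagonal, pi_norm_le_iff_of_nonneg (Real.exp_pos _).le]
  intro j
  rw [Complex.norm_exp]
  apply Real.exp_le_exp.2
  have := diag_re_le h ha j
  simp only [Complex.mul_re, Complex.ofReal_re, Complex.ofReal_im, zero_mul, sub_zero]
  nlinarith

lemma sNorm_apply_le {n : ℕ} (M : Matrix (Fin n) (Fin n) ℂ) (x : EuclideanSpace ℂ (Fin n)) :
    ‖Matrix.toEuclideanCLM (𝕜 := ℂ) M x‖ ≤ sNorm M * ‖x‖ :=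
  ContinuousLinearMap.le_opNorm _ _

lemma sNorm_pos {n : ℕ} (hn : 0 < n) {M : Matrix (Fin n) (Fin n) ℂ} (h : IsUnit M) :
    0 < sNorm M := by
  have : Nonempty (Fin n) := ⟨⟨0, hn⟩⟩
  refine norm_pos_iff.2 fun h0 => ?_
  have : M = 0 := by simpa using h0
  subst this
  exact not_isUnit_zero h

lemma two_step {z : ℕ → ℝ} {q : ℝ} (hz : ∀ m, 0 ≤ z m) (hq0 : 0 ≤ q) (hq : q < 1)
    (h : ∀ m, z (m + 2) ≤ q * z m) : Tendsto z atTop (𝓝 0) := by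
  have key : ∀ m, z (2 * m) ≤ q ^ m * z 0 ∧ z (2 * m + 1) ≤ q ^ m * z 1 := by
    intro m
    induction m with
    | zero => simp
    | succ m ih =>
      have a := h (2 * m)
      have b := h (2 * m + 1)
      constructor
      · calc z (2 * (m + 1)) ≤ q * z (2 * m) := a
          _ ≤ q * (q ^ m * z 0) := mul_le_mul_of_nonneg_left ih.1 hq0
          _ = _ := by ring
      · calc z (2 * (m + 1) + 1) ≤ q * z (2 * m + 1) := b
          _ ≤ q * (q ^ m * z 1) := mul_le_mul_of_nonneg_left ih.2 hq0
          _ = _ := by ring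
  have hb : ∀ m, z m ≤ q ^ (m / 2) * (z 0 + z 1) := by
    intro m
    have hp : 0 ≤ q ^ (m / 2) := pow_nonneg hq0 _
    have h0 := mul_nonneg hp (hz 0)
    have h1 := mul_nonneg hp (hz 1)
    have k := key (m / 2)
    rcases Nat.even_or_odd' m with ⟨j, hj | hj⟩
    · have : 2 * (m / 2) = m := by omega
      rw [this] at k
      linarith [k.1]
    · have : 2 * (m / 2) + 1 = m := by omega
      rw [this] at k
      linarith [k.2]
  have hd : Tendsto (fun m : ℕ => m / 2) atTop atTop :=
    tendsto_atTop_atTop.2 fun b => ⟨2 * b, fun a ha => by omega⟩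
  have hlim := ((tendsto_pow_atTop_nhds_zero_of_lt_one hq0 hq).comp hd).mul_const (z 0 + z 1)
  rw [zero_mul] at hlim
  exact squeeze_zero hz hb hlim

lemma exists_stage {t : ℕ → ℝ} (ht0 : t 0 = 0) (ht : Tendsto t atTop atTop) {s : ℝ} (hs : 0 ≤ s) :
    ∃ m, t m ≤ s ∧ s < t (m + 1) := by
  have hex : ∃ m, s < t m := (ht.eventually_gt_atTop s).exists
  have hne : Nat.find hex ≠ 0 := by
    intro h
    have := Nat.find_spec hex
    rw [h, ht0] at this
    linarith
  obtain ⟨m, hm⟩ := Nat.exists_eq_succ_of_ne_zero hne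
  refine ⟨m, ?_, ?_⟩
  · exact not_lt.1 (Nat.find_min hex (by omega))
  · have := Nat.find_spec hex
    rwa [hm] at this

end helpers

/-- bipartite graph: the vertex classes `{0,…,r-1}` (stable) and `{r,…,k-1}`
(unstable) are the two sides of a bipartite digraph.  If `ln ρ₁ + ln ρ₂ − λτ + μη < 0` then
the switched system is asymptotically stable for every signal in `S_G(τ, η)`. -/
theorem bipartite_stability_dwell_flee {n k : ℕ} (E : Set (Fin k × Fin k))
    (r : ℕ) (hr : 1 ≤ r) (hrk : r < k)
    (hbip : ∀ e ∈ E, (e.1.1 < r ∧ r ≤ e.2.1) ∨ (r ≤ e.1.1 ∧ e.2.1 < r))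
    (A : Fin k → Matrix (Fin n) (Fin n) ℝ) (P D : Fin k → Matrix (Fin n) (Fin n) ℂ)
    (hdiag : ∀ i, Diagonalized (A i) (P i) (D i))
    (hstab : ∀ i : Fin k, i.1 < r → MStable (A i))
    (hunst : ∀ i : Fin k, r ≤ i.1 → MUnstable (A i))
    (lam mu : Fin k → ℝ)
    (hlam : ∀ i : Fin k, i.1 < r → MaxRe (A i) (-(lam i)))
    (hmu : ∀ i : Fin k, r ≤ i.1 → MaxRe (A i) (mu i))
    (ρ₁ ρ₂ lmin mumax : ℝ)
    (hρ₁ : IsGreatest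
      {x : ℝ | ∃ i j : Fin k, (i, j) ∈ E ∧ i.1 < r ∧ x = sNorm ((P j)⁻¹ * P i)} ρ₁)
    (hρ₂ : IsGreatest
      {x : ℝ | ∃ i j : Fin k, (i, j) ∈ E ∧ r ≤ i.1 ∧ x = sNorm ((P j)⁻¹ * P i)} ρ₂)
    (hlmin : IsLeast {x : ℝ | ∃ i : Fin k, i.1 < r ∧ x = lam i} lmin)
    (hmumax : IsGreatest {x : ℝ | ∃ i : Fin k, r ≤ i.1 ∧ x = mu i} mumax)
    (τ η : ℝ) (hτ : 0 < τ) (hη : 0 < η)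
    (hcond : Real.log ρ₁ + Real.log ρ₂ + (-lmin * τ + mumax * η) < 0)
    (t : ℕ → ℝ) (v : ℕ → Fin k) (hadm : Admissible E t v) (hsg : InSG r τ η t v) :
    AsympStable A t v := by
  obtain ⟨ht0, htm, htt, hE⟩ := hadm
  intro x0
  -- positivity of the dimension
  have hn : 0 < n := by
    obtain ⟨z, hz, -⟩ := (hlam ⟨0, by omega⟩ (by show 0 < r; omega)).1
    rcases Nat.eq_zero_or_pos n with h | h
    · subst h
      exfalso
      rw [spectrum.of_subsingleton] at hz
      exact hz
    · exact h
  have hunit : ∀ i j, IsUnit ((P j)⁻¹ * P i) := fun i j =>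
    ((Matrix.isUnit_nonsing_inv_iff).2 (hdiag j).1).mul (hdiag i).1
  have hρ₁pos : 0 < ρ₁ := by
    obtain ⟨i, j, -, -, h⟩ := hρ₁.1
    rw [h]; exact sNorm_pos hn (hunit i j)
  have hρ₂pos : 0 < ρ₂ := by
    obtain ⟨i, j, -, -, h⟩ := hρ₂.1
    rw [h]; exact sNorm_pos hn (hunit i j)
  have hlpos : 0 < lmin := by
    obtain ⟨i, hi, h⟩ := hlmin.1
    obtain ⟨z, hz, hz'⟩ := (hlam i hi).1
    have := hstab i hi z hz
    rw [h]; linarith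
  have hmupos : 0 < mumax := by
    obtain ⟨i, hi, h⟩ := hmumax.1
    obtain ⟨z, hz, hz'⟩ := (hunst i hi).1
    have := (hmu i hi).2 ⟨z, hz, rfl⟩
    rw [h]; linarith
  have hstep : ∀ m, 0 ≤ t (m + 1) - t m := fun m => by
    have := htm (Nat.lt_succ_self m); linarith [this]
  let Em : Fin k → ℝ → Matrix (Fin n) (Fin n) ℂ :=
    fun i u => Matrix.diagonal (fun j => Complex.exp (u * D i j j))
  have hEs : ∀ i : Fin k, i.1 < r → ∀ u, 0 ≤ u → sNorm (Em i u) ≤ Real.exp (-lmin * u) := by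
    intro i hi u hu
    refine (norm_diag_le (hdiag i) (hlam i hi) hu).trans (Real.exp_le_exp.2 ?_)
    have := hlmin.2 ⟨i, hi, rfl⟩
    nlinarith
  have hEu : ∀ i : Fin k, r ≤ i.1 → ∀ u, 0 ≤ u → sNorm (Em i u) ≤ Real.exp (mumax * u) := by
    intro i hi u hu
    refine (norm_diag_le (hdiag i) (hmu i hi) hu).trans (Real.exp_le_exp.2 ?_)
    have := hmumax.2 ⟨i, hi, rfl⟩
    nlinarith
  let y : ℕ → EuclideanSpace ℂ (Fin n) := fun m =>
    Matrix.toEuclideanCLM (𝕜 := ℂ) (P (v m))⁻¹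
      (cvec (Matrix.toEuclideanCLM (𝕜 := ℝ) (flow A t v m) x0))
  have hx : ∀ m u, cvec (Matrix.toEuclideanCLM (𝕜 := ℝ)
      (NormedSpace.exp (u • A (v m)) * flow A t v m) x0)
      = Matrix.toEuclideanCLM (𝕜 := ℂ) (P (v m))
        (Matrix.toEuclideanCLM (𝕜 := ℂ) (Em (v m) u) (y m)) := by
    intro m u
    rw [map_mul, mul_apply_eq_comp, cvec_apply, exp_smul_eq (hdiag (v m)), map_mul,
      map_mul, mul_apply_eq_comp, mul_apply_eq_comp]
  have hy : ∀ m, ‖y (m + 1)‖ ≤ sNorm ((P (v (m + 1)))⁻¹ * P (v m)) *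
      (sNorm (Em (v m) (t (m + 1) - t m)) * ‖y m‖) := by
    intro m
    have h1 : y (m + 1) = Matrix.toEuclideanCLM (𝕜 := ℂ) ((P (v (m + 1)))⁻¹ * P (v m))
        (Matrix.toEuclideanCLM (𝕜 := ℂ) (Em (v m) (t (m + 1) - t m)) (y m)) := by
      rw [map_mul, mul_apply_eq_comp, ← hx]
      rfl
    rw [h1]
    exact (sNorm_apply_le _ _).trans
      (mul_le_mul_of_nonneg_left (sNorm_apply_le _ _) (norm_nonneg _))
  have hys : ∀ m, (v m).1 < r → ‖y (m + 1)‖ ≤ ρ₁ * Real.exp (-lmin * τ) * ‖y m‖ := by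
    intro m hm
    refine (hy m).trans ?_
    rw [← mul_assoc]
    have h1 := hρ₁.2 ⟨v m, v (m + 1), hE m, hm, rfl⟩
    have h2 : sNorm (Em (v m) (t (m + 1) - t m)) ≤ Real.exp (-lmin * τ) := by
      refine (hEs _ hm _ (hstep m)).trans (Real.exp_le_exp.2 ?_)
      have := (hsg m).1 hm
      nlinarith
    exact mul_le_mul_of_nonneg_right (mul_le_mul h1 h2 (norm_nonneg _) hρ₁pos.le) (norm_nonneg _)
  have hyu : ∀ m, r ≤ (v m).1 → ‖y (m + 1)‖ ≤ ρ₂ * Real.exp (mumax * η) * ‖y m‖ := by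
    intro m hm
    refine (hy m).trans ?_
    rw [← mul_assoc]
    have h1 := hρ₂.2 ⟨v m, v (m + 1), hE m, hm, rfl⟩
    have h2 : sNorm (Em (v m) (t (m + 1) - t m)) ≤ Real.exp (mumax * η) := by
      refine (hEu _ hm _ (hstep m)).trans (Real.exp_le_exp.2 ?_)
      have := (hsg m).2 hm
      nlinarith
    exact mul_le_mul_of_nonneg_right (mul_le_mul h1 h2 (norm_nonneg _) hρ₂pos.le) (norm_nonneg _)
  have hg1 : 0 < ρ₁ * Real.exp (-lmin * τ) := by positivity
  have hg2 : 0 < ρ₂ * Real.exp (mumax * η) := by positivity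
  have hq : (ρ₁ * Real.exp (-lmin * τ)) * (ρ₂ * Real.exp (mumax * η)) < 1 := by
    rw [← Real.exp_log hρ₁pos, ← Real.exp_log hρ₂pos, ← Real.exp_add, ← Real.exp_add,
      ← Real.exp_add, Real.exp_lt_one_iff]
    linarith
  have hz : Tendsto (fun m => ‖y m‖) atTop (𝓝 0) := by
    refine two_step (fun m => norm_nonneg _) (by positivity) hq fun m => ?_
    rcases hbip _ (hE m) with ⟨h1, h2⟩ | ⟨h1, h2⟩
    · calc ‖y (m + 2)‖ ≤ ρ₂ * Real.exp (mumax * η) * ‖y (m + 1)‖ := hyu (m + 1) h2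
        _ ≤ ρ₂ * Real.exp (mumax * η) * (ρ₁ * Real.exp (-lmin * τ) * ‖y m‖) :=
          mul_le_mul_of_nonneg_left (hys m h1) hg2.le
        _ = _ := by ring
    · calc ‖y (m + 2)‖ ≤ ρ₁ * Real.exp (-lmin * τ) * ‖y (m + 1)‖ := hys (m + 1) h2
        _ ≤ ρ₁ * Real.exp (-lmin * τ) * (ρ₂ * Real.exp (mumax * η) * ‖y m‖) :=
          mul_le_mul_of_nonneg_left (hyu m h1) hg1.le
        _ = _ := by ring
  -- bound for the solution
  let K : ℝ := (∑ i, sNorm (P i)) * Real.exp (mumax * η)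
  have hbound : ∀ m s, t m ≤ s → s < t (m + 1) →
      ‖Matrix.toEuclideanCLM (𝕜 := ℝ)
        (NormedSpace.exp ((s - t m) • A (v m)) * flow A t v m) x0‖ ≤ K * ‖y m‖ := by
    intro m s h1 h2
    rw [← norm_cvec, hx]
    have hP : sNorm (P (v m)) ≤ ∑ i, sNorm (P i) :=
      Finset.single_le_sum (f := fun i => sNorm (P i)) (fun i _ => norm_nonneg _)
        (Finset.mem_univ (v m))
    have hEm : sNorm (Em (v m) (s - t m)) ≤ Real.exp (mumax * η) := by
      rcases lt_or_ge (v m).1 r with h | h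
      · refine (hEs _ h _ (by linarith)).trans (Real.exp_le_exp.2 ?_)
        have : 0 < mumax * η := by positivity
        have : 0 ≤ lmin * (s - t m) := mul_nonneg hlpos.le (by linarith)
        linarith
      · refine (hEu _ h _ (by linarith)).trans (Real.exp_le_exp.2 ?_)
        have := (hsg m).2 h
        exact mul_le_mul_of_nonneg_left (by linarith) hmupos.le
    have hP0 : 0 ≤ sNorm (P (v m)) := norm_nonneg _
    calc _ ≤ sNorm (P (v m)) * (sNorm (Em (v m) (s - t m)) * ‖y m‖) :=
          (sNorm_apply_le _ _).trans
            (mul_le_mul_of_nonneg_left (sNorm_apply_le _ _) (norm_nonneg _))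
      _ = sNorm (P (v m)) * sNorm (Em (v m) (s - t m)) * ‖y m‖ := by ring
      _ ≤ K * ‖y m‖ := mul_le_mul_of_nonneg_right
          (mul_le_mul hP hEm (norm_nonneg _) (hP0.trans hP)) (norm_nonneg _)
  have hKz : Tendsto (fun m => K * ‖y m‖) atTop (𝓝 0) := by
    simpa using hz.const_mul K
  rw [Metric.tendsto_atTop]
  intro ε hε
  obtain ⟨N, hN⟩ := eventually_atTop.1 (hKz.eventually (gt_mem_nhds hε))
  refine ⟨t N, fun s hs => ?_⟩
  have hs0 : 0 ≤ s := by
    have := htm.monotone (Nat.zero_le N)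
    linarith
  have hex := exists_stage ht0 htt hs0
  have hspec := hex.choose_spec
  have hle : N ≤ hex.choose := by
    have := htm.lt_iff_lt.1 (lt_of_le_of_lt hs hspec.2)
    omega
  have hsol : ‖sol A t v x0 s‖ ≤ K * ‖y hex.choose‖ := by
    unfold sol pc
    rw [dif_pos hex]
    exact hbound _ _ hspec.1 hspec.2
  rw [dist_zero_right, norm_norm]
  exact hsol.trans_lt (hN _ hle)
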